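/- arXiv:2406.11575 — 3 statements merged into one kernel-verified Lean document; each statement's English description precedes it below -/
import Mathlib

section
/- Let K, M ∈ ℝ^{N×N} be symmetric positive definite matrices, let x̃ ∈ ℝ^N be nonzero, let λ̃ ∈ ℝ, and set r = K x̃ − λ̃ M x̃. Then there exists a generalized eigenvalue λ of the pair (K, M), i.e. a real λ with K v = λ M v for some nonzero v ∈ ℝ^N, such that |λ − λ̃| ≤ √( (rᵀ M⁻¹ r) / (x̃ᵀ M x̃) ). -/
open Matrix

/-- Some eigenvalue of a symmetric operator lies within `‖T y - a • y‖ / ‖y‖` of `a`. -/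
theorem LinearMap.IsSymmetric.exists_eigenvalue_abs_sub_mul_norm_le
    {E : Type*} [NormedAddCommGroup E] [InnerProductSpace ℝ E] [FiniteDimensional ℝ E]
    {T : E →ₗ[ℝ] E} (hT : T.IsSymmetric) {y : E} (hy : y ≠ 0) (a : ℝ) :
    ∃ (μ : ℝ) (v : E), v ≠ 0 ∧ T v = μ • v ∧ |μ - a| * ‖y‖ ≤ ‖T y - a • y‖ := by
  have : Nontrivial E := ⟨y, 0, hy⟩
  let b := hT.eigenvectorBasis rfl
  let ev := hT.eigenvalues rfl
  have : Nonempty (Fin (Module.finrank ℝ E)) := ⟨⟨0, Module.finrank_pos⟩⟩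
  obtain ⟨i, hi⟩ := Finite.exists_min fun i => |ev i - a|
  have hb (j) : T (b j) = ev j • b j := hT.apply_eigenvectorBasis rfl j
  refine ⟨ev i, b i, b.orthonormal.ne_zero i, hb i, ?_⟩
  refine (pow_le_pow_iff_left₀ (by positivity) (norm_nonneg _) two_ne_zero).mp ?_
  rw [mul_pow, ← b.sum_sq_norm_inner_right y, ← b.sum_sq_norm_inner_right (T y - a • y),
    Finset.mul_sum]
  refine Finset.sum_le_sum fun j _ => ?_
  have hj : inner ℝ (b j) (T y - a • y) = (ev j - a) * inner ℝ (b j) y := by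
    rw [inner_sub_right, ← hT, hb, real_inner_smul_left, real_inner_smul_right, sub_mul]
  rw [hj, norm_mul, mul_pow, Real.norm_eq_abs (ev j - a)]
  exact mul_le_mul_of_nonneg_right (pow_le_pow_left₀ (abs_nonneg _) (hi j) 2) (sq_nonneg _)

/-- Matrix form of the residual bound: some eigenvalue of a symmetric matrix `A` lies within
`|A y - a y| / |y|` of `a`, in the Euclidean norm. -/
theorem Matrix.IsHermitian.exists_eigenvalue_sq_sub_mul_dotProduct_le
    {n : Type*} [Fintype n] [DecidableEq n] {A : Matrix n n ℝ} (hA : A.IsHermitian)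
    {y : n → ℝ} (hy : y ≠ 0) (a : ℝ) :
    ∃ (μ : ℝ) (v : n → ℝ), v ≠ 0 ∧ A *ᵥ v = μ • v ∧
      (μ - a) ^ 2 * (y ⬝ᵥ y) ≤ (A *ᵥ y - a • y) ⬝ᵥ (A *ᵥ y - a • y) := by
  have norm_sq (z : n → ℝ) : ‖WithLp.toLp 2 z‖ ^ 2 = z ⬝ᵥ z := by
    rw [← real_inner_self_eq_norm_sq, EuclideanSpace.inner_toLp_toLp, star_trivial]
  obtain ⟨μ, v, hv, hAv, hle⟩ :=
    (isSymmetric_toEuclideanLin_iff.mpr hA).exists_eigenvalue_abs_sub_mul_norm_le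
      (y := WithLp.toLp 2 y) (by simpa using hy) a
  refine ⟨μ, v.ofLp, by simpa using hv, by simpa using congrArg WithLp.ofLp hAv, ?_⟩
  have hsq := pow_le_pow_left₀ (by positivity) hle 2
  rw [mul_pow, sq_abs, norm_sq, toLpLin_toLp, ← WithLp.toLp_smul, ← WithLp.toLp_sub,
    norm_sq] at hsq
  simpa using hsq

open scoped MatrixOrder Matrix.Norms.L2Operator in
/-- A real positive semidefinite matrix is a Gram matrix. -/
theorem Matrix.PosSemidef.exists_eq_transpose_mul_self
    {n : Type*} [Fintype n] [DecidableEq n] {A : Matrix n n ℝ} (hA : A.PosSemidef) :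
    ∃ B : Matrix n n ℝ, A = Bᵀ * B := by
  obtain ⟨B, hB⟩ := CStarAlgebra.nonneg_iff_eq_star_mul_self.mp hA.nonneg
  exact ⟨B, by rwa [star_eq_conjTranspose, conjTranspose_eq_transpose_of_trivial] at hB⟩

/-- Residual-based eigenvalue enclosure: given symmetric positive definite `K, M`, an
approximate eigenpair `(λ̃, x̃)` with residual `r = K x̃ − λ̃ M x̃`, the interval
`[λ̃ − √(rᵀM⁻¹r / x̃ᵀMx̃), λ̃ + √(rᵀM⁻¹r / x̃ᵀMx̃)]` contains a generalized eigenvalue of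
`(K, M)`. -/
theorem generalized_eigenvalue_residual_enclosure {N : ℕ}
    (K M : Matrix (Fin N) (Fin N) ℝ) (hK : K.PosDef) (hM : M.PosDef)
    (xt : Fin N → ℝ) (hxt : xt ≠ 0) (lamt : ℝ)
    (r : Fin N → ℝ) (hr : r = K.mulVec xt - lamt • M.mulVec xt) :
    ∃ (lam : ℝ) (v : Fin N → ℝ), v ≠ 0 ∧ K.mulVec v = lam • M.mulVec v ∧
      |lam - lamt| ≤ Real.sqrt ((r ⬝ᵥ M⁻¹.mulVec r) / (xt ⬝ᵥ M.mulVec xt)) := by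
  obtain ⟨B, hB⟩ := hM.posSemidef.exists_eq_transpose_mul_self
  have hBu : IsUnit B.det := by
    have h := hM.det_pos.ne'
    rw [hB, det_mul] at h
    exact (right_ne_zero_of_mul h).isUnit
  have hBtu : IsUnit Bᵀ.det := by rwa [det_transpose]
  have hBx : B *ᵥ xt ≠ 0 := fun h => hxt <| by
    simpa [mulVec_mulVec, nonsing_inv_mul _ hBu] using congrArg (B⁻¹ *ᵥ ·) h
  have hA : ((B⁻¹)ᵀ * K * B⁻¹).IsHermitian := by
    simpa using isHermitian_conjTranspose_mul_mul B⁻¹ hK.isHermitian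
  obtain ⟨lam, u, hu, hAu, hle⟩ :=
    hA.exists_eigenvalue_sq_sub_mul_dotProduct_le hBx lamt
  have hKu : K *ᵥ (B⁻¹ *ᵥ u) = Bᵀ *ᵥ (((B⁻¹)ᵀ * K * B⁻¹) *ᵥ u) := by
    rw [mulVec_mulVec, mulVec_mulVec, transpose_nonsing_inv, Matrix.mul_assoc,
      mul_nonsing_inv_cancel_left _ _ hBtu]
  have hMu : M *ᵥ (B⁻¹ *ᵥ u) = Bᵀ *ᵥ u := by
    rw [hB, mulVec_mulVec, mul_nonsing_inv_cancel_right _ _ hBu]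
  have hres : ((B⁻¹)ᵀ * K * B⁻¹) *ᵥ (B *ᵥ xt) - lamt • B *ᵥ xt = (B⁻¹)ᵀ *ᵥ r := by
    rw [hr, hB, mulVec_sub, mulVec_smul, mulVec_mulVec, mulVec_mulVec, mulVec_mulVec,
      nonsing_inv_mul_cancel_right _ _ hBu, transpose_nonsing_inv,
      nonsing_inv_mul_cancel_left _ _ hBtu]
  have hnum : ((B⁻¹)ᵀ *ᵥ r) ⬝ᵥ ((B⁻¹)ᵀ *ᵥ r) = r ⬝ᵥ M⁻¹ *ᵥ r := by
    rw [hB, Matrix.mul_inv_rev, ← transpose_nonsing_inv, ← mulVec_mulVec, dotProduct_mulVec r,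
      mulVec_transpose]
  have hden : (B *ᵥ xt) ⬝ᵥ (B *ᵥ xt) = xt ⬝ᵥ M *ᵥ xt := by
    rw [hB, ← mulVec_mulVec, dotProduct_mulVec xt, vecMul_transpose]
  have hpos : 0 < xt ⬝ᵥ M *ᵥ xt := by simpa using hM.dotProduct_mulVec_pos hxt
  refine ⟨lam, B⁻¹ *ᵥ u, fun h => hu ?_, by rw [hKu, hAu, hMu, mulVec_smul], ?_⟩
  · simpa [mulVec_mulVec, mul_nonsing_inv _ hBu] using congrArg (B *ᵥ ·) h
  · rw [hres, hnum, hden] at hle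
    exact Real.abs_le_sqrt ((le_div_iff₀ hpos).mpr hle)
end

section
/- Let K, M ∈ ℝ^{N×N} be symmetric positive definite, let λ̃ ∈ ℝ, a > 0, and let x̃ ∈ ℝ^N with residual r = K x̃ − λ̃ M x̃. Suppose λ* is a simple generalized eigenvalue of (K, M) and every other generalized eigenvalue λ' of (K, M) satisfies |λ' − λ̃| ≥ a. Assume moreover that x̃ᵀ M x̃ − (rᵀ M⁻¹ r)/a² ≥ 0. Then there exists an eigenvector x* with K x* = λ* M x* and (x*)ᵀ M x* = 1 such that (x̃ − x*)ᵀ M (x̃ − x*) ≤ (rᵀ M⁻¹ r)/a² + max{ (√(x̃ᵀ M x̃) − 1)², (1 − √( x̃ᵀ M x̃ − (rᵀ M⁻¹ r)/a² ))² }. -/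
open Matrix

open scoped MatrixOrder in
/-- A symmetric pair `(K, M)` with `M` positive definite is simultaneously diagonalizable by
congruence. -/
theorem exists_simultaneous_diagonalization {n : Type*} [Fintype n] [DecidableEq n]
    {K M : Matrix n n ℝ} (hK : K.IsHermitian) (hM : M.PosDef) :
    ∃ (P : Matrix n n ℝ) (d : n → ℝ), Pᵀ * M * P = 1 ∧ K * P = M * P * diagonal d := by
  obtain ⟨B, hB, rfl⟩ : ∃ B : Matrix n n ℝ, IsUnit B ∧ M = Bᵀ * B :=
    CStarAlgebra.isStrictlyPositive_iff_eq_star_mul_self.mp hM.isStrictlyPositive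
  have hBdet : IsUnit B.det := (Matrix.isUnit_iff_isUnit_det B).mp hB
  have hBB : B * B⁻¹ = 1 := mul_nonsing_inv B hBdet
  have hBT : B⁻¹ᵀ * Bᵀ = 1 := by rw [← transpose_mul, hBB, transpose_one]
  have hBT' : Bᵀ * B⁻¹ᵀ = 1 := mul_eq_one_comm.mp hBT
  have hC : (B⁻¹ᵀ * K * B⁻¹).IsHermitian := by
    have h := isHermitian_conjTranspose_mul_mul B⁻¹ hK
    rwa [conjTranspose_eq_transpose_of_trivial] at h
  set U : Matrix n n ℝ := hC.eigenvectorUnitary.val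
  have hU : Uᵀ * U = 1 := by
    have h := Unitary.coe_star_mul_self hC.eigenvectorUnitary
    rwa [star_eq_conjTranspose, conjTranspose_eq_transpose_of_trivial] at h
  have hspec : B⁻¹ᵀ * K * B⁻¹ = U * diagonal hC.eigenvalues * Uᵀ := by
    have h := hC.spectral_theorem
    rw [Unitary.conjStarAlgAut_apply, star_eq_conjTranspose,
      conjTranspose_eq_transpose_of_trivial] at h
    exact h
  refine ⟨B⁻¹ * U, hC.eigenvalues, ?_, ?_⟩
  · calc (B⁻¹ * U)ᵀ * (Bᵀ * B) * (B⁻¹ * U)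
        = Uᵀ * (B⁻¹ᵀ * Bᵀ) * (B * B⁻¹) * U := by simp only [transpose_mul, Matrix.mul_assoc]
      _ = 1 := by rw [hBT, hBB, Matrix.mul_one, Matrix.mul_one, hU]
  · calc K * (B⁻¹ * U) = Bᵀ * B⁻¹ᵀ * K * (B⁻¹ * U) := by rw [hBT', Matrix.one_mul]
      _ = Bᵀ * (B⁻¹ᵀ * K * B⁻¹) * U := by simp only [Matrix.mul_assoc]
      _ = Bᵀ * (U * diagonal hC.eigenvalues * Uᵀ) * U := congrArg (Bᵀ * · * U) hspec
      _ = Bᵀ * U * diagonal hC.eigenvalues * (Uᵀ * U) := by simp only [Matrix.mul_assoc]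
      _ = Bᵀ * (B * B⁻¹) * U * diagonal hC.eigenvalues := by
          rw [hU, hBB, Matrix.mul_one, Matrix.mul_one]
      _ = Bᵀ * B * (B⁻¹ * U) * diagonal hC.eigenvalues := by simp only [Matrix.mul_assoc]

theorem sq_sub_one_le_max {l t u : ℝ} (hl : l ≤ t) (hu : t ≤ u) :
    (t - 1) ^ 2 ≤ max ((u - 1) ^ 2) ((1 - l) ^ 2) := by
  rcases le_total 1 t with h | h
  · exact le_max_of_le_left (by nlinarith)
  · exact le_max_of_le_right (by nlinarith)

/-- Replacing all but the `i₀`-th coordinate by zero and normalizing the `i₀`-th one moves `c` by a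
distance controlled by any upper bound `ρ` on the discarded squared norm. -/
theorem exists_sign_dist_sq_le {n : Type*} [Fintype n] [DecidableEq n]
    (c : n → ℝ) (i₀ : n) {ρ : ℝ} (hρ : ∑ i ∈ Finset.univ.erase i₀, c i ^ 2 ≤ ρ) :
    ∃ s : ℝ, s ^ 2 = 1 ∧ (c - Pi.single i₀ s) ⬝ᵥ (c - Pi.single i₀ s) ≤
      ρ + max ((Real.sqrt (c ⬝ᵥ c) - 1) ^ 2) ((1 - Real.sqrt (c ⬝ᵥ c - ρ)) ^ 2) := by
  obtain ⟨s, hs, hsc⟩ : ∃ s : ℝ, s ^ 2 = 1 ∧ (c i₀ - s) ^ 2 = (|c i₀| - 1) ^ 2 := by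
    rcases abs_cases (c i₀) with ⟨h, _⟩ | ⟨h, _⟩
    · exact ⟨1, by norm_num, by rw [h]⟩
    · exact ⟨-1, by norm_num, by rw [h]; ring⟩
  have hc : c ⬝ᵥ c = c i₀ ^ 2 + ∑ i ∈ Finset.univ.erase i₀, c i ^ 2 := by
    rw [Finset.add_sum_erase _ (fun i => c i ^ 2) (Finset.mem_univ i₀)]
    simp only [dotProduct, sq]
  have hd : (c - Pi.single i₀ s) ⬝ᵥ (c - Pi.single i₀ s) =
      (c i₀ - s) ^ 2 + ∑ i ∈ Finset.univ.erase i₀, c i ^ 2 := by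
    simp only [dotProduct, ← sq]
    rw [← Finset.add_sum_erase _ _ (Finset.mem_univ i₀)]
    congr 1
    · simp
    · refine Finset.sum_congr rfl fun i hi => ?_
      simp [Finset.ne_of_mem_erase hi]
  refine ⟨s, hs, ?_⟩
  have hq : 0 ≤ ∑ i ∈ Finset.univ.erase i₀, c i ^ 2 := Finset.sum_nonneg fun i _ => sq_nonneg _
  have hl : Real.sqrt (c ⬝ᵥ c - ρ) ≤ |c i₀| := by
    rw [← Real.sqrt_sq_eq_abs]
    exact Real.sqrt_le_sqrt (by linarith)
  have hu : |c i₀| ≤ Real.sqrt (c ⬝ᵥ c) := by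
    rw [← Real.sqrt_sq_eq_abs]
    exact Real.sqrt_le_sqrt (by linarith)
  have := sq_sub_one_le_max hl hu
  linarith

/-- Residual-based eigenvector enclosure: if `λ*` is a simple generalized eigenvalue of the
symmetric positive definite pair `(K, M)` and all other generalized eigenvalues are at
distance at least `a` from the approximate value `λ̃`, then there is an `M`-normalized
eigenvector `x*` for `λ*` whose `M`-distance to the approximate eigenvector `x̃` is
controlled by the residual `r = K x̃ − λ̃ M x̃`. -/
theorem generalized_eigenvector_residual_enclosure {N : ℕ}
    (K M : Matrix (Fin N) (Fin N) ℝ) (hK : K.PosDef) (hM : M.PosDef)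
    (lamt a : ℝ) (ha : 0 < a) (xt : Fin N → ℝ)
    (r : Fin N → ℝ) (hr : r = K.mulVec xt - lamt • M.mulVec xt)
    (lamstar : ℝ)
    (hsimple : Module.finrank ℝ
      (LinearMap.ker (Matrix.toLin' (K - lamstar • M))) = 1)
    (hothers : ∀ lam' : ℝ, lam' ≠ lamstar →
      (∃ v : Fin N → ℝ, v ≠ 0 ∧ K.mulVec v = lam' • M.mulVec v) →
      a ≤ |lam' - lamt|)
    (hnn : 0 ≤ xt ⬝ᵥ M.mulVec xt - (r ⬝ᵥ M⁻¹.mulVec r) / a ^ 2) :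
    ∃ xstar : Fin N → ℝ,
      K.mulVec xstar = lamstar • M.mulVec xstar ∧
      xstar ⬝ᵥ M.mulVec xstar = 1 ∧
      (xt - xstar) ⬝ᵥ M.mulVec (xt - xstar) ≤
        (r ⬝ᵥ M⁻¹.mulVec r) / a ^ 2 +
          max ((Real.sqrt (xt ⬝ᵥ M.mulVec xt) - 1) ^ 2)
            ((1 - Real.sqrt (xt ⬝ᵥ M.mulVec xt - (r ⬝ᵥ M⁻¹.mulVec r) / a ^ 2)) ^ 2) := by
  obtain ⟨P, d, hP, hKP⟩ := exists_simultaneous_diagonalization hK.isHermitian hM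
  have hPM : P * (Pᵀ * M) = 1 := mul_eq_one_comm.mp hP
  have hMP : M * (P * Pᵀ) = 1 := by
    rw [← Matrix.mul_assoc, mul_eq_one_comm, ← Matrix.mul_assoc]
    exact hP
  have hMinv : M⁻¹ = P * Pᵀ := inv_eq_right_inv hMP
  have hsurj (x : Fin N → ℝ) : P *ᵥ ((Pᵀ * M) *ᵥ x) = x := by rw [mulVec_mulVec, hPM, one_mulVec]
  have hKvec (w : Fin N → ℝ) : K *ᵥ (P *ᵥ w) = M *ᵥ (P *ᵥ fun i => d i * w i) := by
    have hw : (fun i => d i * w i) = diagonal d *ᵥ w := by ext i; rw [mulVec_diagonal]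
    rw [hw, mulVec_mulVec, hKP, mulVec_mulVec, mulVec_mulVec, Matrix.mul_assoc]
  have hdot (v w : Fin N → ℝ) : (P *ᵥ v) ⬝ᵥ M *ᵥ (P *ᵥ w) = v ⬝ᵥ w := by
    rw [← vecMul_transpose, ← dotProduct_mulVec, mulVec_mulVec, mulVec_mulVec, hP, one_mulVec]
  have hinj {v w : Fin N → ℝ} (h : M *ᵥ (P *ᵥ v) = M *ᵥ (P *ᵥ w)) : v = w := by
    have := congrArg (Pᵀ *ᵥ ·) h
    simpa only [mulVec_mulVec, ← Matrix.mul_assoc, hP, one_mulVec] using this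
  have hcol (i : Fin N) (s : ℝ) :
      K *ᵥ (P *ᵥ Pi.single i s) = d i • M *ᵥ (P *ᵥ Pi.single i s) := by
    rw [hKvec, ← mulVec_smul, ← mulVec_smul]
    congr 2
    ext j
    rcases eq_or_ne j i with rfl | hj
    · simp
    · simp [hj]
  have hmem (x : Fin N → ℝ) : x ∈ LinearMap.ker (toLin' (K - lamstar • M)) ↔
      K *ᵥ x = lamstar • M *ᵥ x := by
    rw [LinearMap.mem_ker, toLin'_apply, sub_mulVec, smul_mulVec, sub_eq_zero]
  have hne (i : Fin N) : P *ᵥ Pi.single i (1 : ℝ) ≠ 0 := by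
    intro h
    have := hdot (Pi.single i 1) (Pi.single i 1)
    simp [h] at this
  obtain ⟨⟨v, hv⟩, hv0, hspan⟩ := finrank_eq_one_iff'.mp hsimple
  rw [hmem] at hv
  obtain ⟨w, rfl⟩ : ∃ w, P *ᵥ w = v := ⟨_, hsurj v⟩
  have hdw : (fun i => d i * w i) = lamstar • w := by
    refine hinj ?_
    rw [← hKvec, hv, mulVec_smul, mulVec_smul]
  obtain ⟨i₀, hi₀⟩ : ∃ i, w i ≠ 0 := by
    by_contra! h
    obtain rfl : w = 0 := funext h
    exact hv0 (by simp)
  have hdi₀ : d i₀ = lamstar := mul_right_cancel₀ hi₀ (congrFun hdw i₀)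
  have hd (j : Fin N) (hj : j ≠ i₀) : d j ≠ lamstar := by
    intro hdj
    obtain ⟨t, ht⟩ : ∃ t : ℝ, t • w = Pi.single j 1 := by
      obtain ⟨t, ht⟩ := hspan ⟨P *ᵥ Pi.single j 1, (hmem _).mpr (by rw [hcol, hdj])⟩
      refine ⟨t, hinj ?_⟩
      rw [mulVec_smul]
      exact congrArg (M *ᵥ ·) (congrArg Subtype.val ht)
    have h1 := congrFun ht i₀
    have h2 := congrFun ht j
    simp [hj.symm, hi₀] at h1
    simp [h1] at h2
  have hgap (j : Fin N) (hj : j ≠ i₀) : a ≤ |d j - lamt| :=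
    hothers _ (hd j hj) ⟨_, hne j, hcol j 1⟩
  obtain ⟨c, rfl⟩ : ∃ c, P *ᵥ c = xt := ⟨_, hsurj xt⟩
  have hres : r ⬝ᵥ M⁻¹ *ᵥ r = ∑ i, ((d i - lamt) * c i) ^ 2 := by
    have hr' : r = M *ᵥ (P *ᵥ fun i => (d i - lamt) * c i) := by
      rw [hr, hKvec, ← mulVec_smul, ← mulVec_smul, ← mulVec_sub, ← mulVec_sub]
      congr 2
      ext i
      simp [sub_mul]
    have hMr : M⁻¹ *ᵥ r = P *ᵥ fun i => (d i - lamt) * c i := by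
      rw [hr', mulVec_mulVec, nonsing_inv_mul _ ((Matrix.isUnit_iff_isUnit_det M).mp hM.isUnit),
        one_mulVec]
    rw [hMr, hr', dotProduct_comm, hdot]
    simp only [dotProduct, ← sq]
  have hρ : ∑ i ∈ Finset.univ.erase i₀, c i ^ 2 ≤ (r ⬝ᵥ M⁻¹ *ᵥ r) / a ^ 2 := by
    rw [le_div_iff₀ (by positivity), hres, Finset.sum_mul]
    calc ∑ i ∈ Finset.univ.erase i₀, c i ^ 2 * a ^ 2
        ≤ ∑ i ∈ Finset.univ.erase i₀, ((d i - lamt) * c i) ^ 2 := by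
          refine Finset.sum_le_sum fun i hi => ?_
          have h : a ^ 2 ≤ (d i - lamt) ^ 2 := by
            rw [← sq_abs (d i - lamt)]
            exact pow_le_pow_left₀ ha.le (hgap i (Finset.ne_of_mem_erase hi)) 2
          rw [mul_pow, mul_comm]
          exact mul_le_mul_of_nonneg_right h (sq_nonneg _)
      _ ≤ ∑ i, ((d i - lamt) * c i) ^ 2 :=
          Finset.sum_le_sum_of_subset_of_nonneg (Finset.erase_subset _ _)
            fun i _ _ => sq_nonneg _
  obtain ⟨s, hs, hle⟩ := exists_sign_dist_sq_le c i₀ hρ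
  refine ⟨P *ᵥ Pi.single i₀ s, ?_, ?_, ?_⟩
  · rw [hcol, hdi₀]
  · rw [hdot]
    simpa [sq] using hs
  · rw [← mulVec_sub, hdot, hdot]
    exact hle
end

section
/- Let K, M ∈ ℝ^{d×d} be symmetric with M positive definite. Let λ₁ < λ₂ be real numbers and let u₁ ∈ ℝ^d satisfy K u₁ = λ₁ M u₁ and u₁ᵀ M u₁ = 1. Assume the spectral gap condition: for every x ∈ ℝ^d with u₁ᵀ M x = 0 one has xᵀ K x ≥ λ₂ · xᵀ M x. Then for every w > 0 and every x ∈ ℝ^d, xᵀ (K − λ₁ M) x + w (u₁ᵀ M x)² ≥ min{λ₂ − λ₁, w} · xᵀ M x. In particular the matrix K − λ₁ M + w (M u₁)(M u₁)ᵀ is positive definite. -/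
open Matrix

theorem dotProduct_mulVec_comm_of_isSymm {n R : Type*} [Fintype n] [CommRing R]
    {A : Matrix n n R} (hA : A.IsSymm) (x y : n → R) :
    x ⬝ᵥ A.mulVec y = y ⬝ᵥ A.mulVec x := by
  rw [← dotProduct_transpose_mulVec, hA.eq]

/-- The quadratic form of a symmetric matrix at `x - a • u`. -/
theorem dotProduct_mulVec_sub_smul_self {n R : Type*} [Fintype n] [CommRing R]
    {A : Matrix n n R} (hA : A.IsSymm) (x u : n → R) (a : R) :
    (x - a • u) ⬝ᵥ A.mulVec (x - a • u) =
      x ⬝ᵥ A.mulVec x - 2 * a * (x ⬝ᵥ A.mulVec u) + a ^ 2 * (u ⬝ᵥ A.mulVec u) := by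
  simp only [mulVec_sub, mulVec_smul, sub_dotProduct, dotProduct_sub, smul_dotProduct,
    dotProduct_smul, smul_eq_mul, dotProduct_mulVec_comm_of_isSymm hA u x]
  ring

/-- Coercivity of the regularized saddle point operator: if `(λ₁, u₁)` is an `M`-normalized
generalized eigenpair of `(K, M)` and the spectral gap condition holds with `λ₂ > λ₁`, then
for every `w > 0` and every `x`,
`xᵀ(K − λ₁M)x + w (u₁ᵀMx)² ≥ min{λ₂ − λ₁, w} xᵀMx`, and in particular
`K − λ₁M + w (Mu₁)(Mu₁)ᵀ` is positive definite. -/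
theorem regularized_pencil_coercive {d : ℕ}
    (K M : Matrix (Fin d) (Fin d) ℝ) (hK : K.IsSymm) (hM : M.PosDef)
    (lam1 lam2 : ℝ) (hlt : lam1 < lam2)
    (u1 : Fin d → ℝ)
    (heig : K.mulVec u1 = lam1 • M.mulVec u1)
    (hnorm : u1 ⬝ᵥ M.mulVec u1 = 1)
    (hgap : ∀ x : Fin d → ℝ, u1 ⬝ᵥ M.mulVec x = 0 →
      lam2 * (x ⬝ᵥ M.mulVec x) ≤ x ⬝ᵥ K.mulVec x) :
    ∀ w : ℝ, 0 < w →
      (∀ x : Fin d → ℝ,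
        min (lam2 - lam1) w * (x ⬝ᵥ M.mulVec x) ≤
          x ⬝ᵥ (K - lam1 • M).mulVec x + w * (u1 ⬝ᵥ M.mulVec x) ^ 2) ∧
      (K - lam1 • M + w • Matrix.vecMulVec (M.mulVec u1) (M.mulVec u1)).PosDef := by
  intro w hw
  have hMs : M.IsSymm := by simpa [IsHermitian, IsSymm] using hM.isHermitian
  have hMnonneg (y : Fin d → ℝ) : 0 ≤ y ⬝ᵥ M.mulVec y := by
    simpa using hM.posSemidef.dotProduct_mulVec_nonneg y
  have hbound (x : Fin d → ℝ) : min (lam2 - lam1) w * (x ⬝ᵥ M.mulVec x) ≤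
      x ⬝ᵥ (K - lam1 • M).mulVec x + w * (u1 ⬝ᵥ M.mulVec x) ^ 2 := by
    have hxu : x ⬝ᵥ M.mulVec u1 = u1 ⬝ᵥ M.mulVec x :=
      dotProduct_mulVec_comm_of_isSymm hMs x u1
    set a := u1 ⬝ᵥ M.mulVec x with ha
    have horth : u1 ⬝ᵥ M.mulVec (x - a • u1) = 0 := by
      simp [mulVec_sub, mulVec_smul, dotProduct_sub, hnorm, ← ha]
    have hgap_y := hgap _ horth
    have hy := hMnonneg (x - a • u1)
    rw [dotProduct_mulVec_sub_smul_self hMs, hxu, hnorm] at hy hgap_y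
    rw [dotProduct_mulVec_sub_smul_self hK, heig, dotProduct_smul, dotProduct_smul, hxu, hnorm,
      smul_eq_mul, smul_eq_mul] at hgap_y
    rw [sub_mulVec, smul_mulVec, dotProduct_sub, dotProduct_smul, smul_eq_mul]
    have h₁ := mul_le_mul_of_nonneg_right (min_le_left (lam2 - lam1) w) hy
    have h₂ := mul_le_mul_of_nonneg_right (min_le_right (lam2 - lam1) w) (sq_nonneg a)
    linarith
  refine ⟨hbound, PosDef.of_dotProduct_mulVec_pos ?_ fun x hx => ?_⟩
  · simp [IsHermitian, conjTranspose_eq_transpose_of_trivial, transpose_vecMulVec, hK.eq, hMs.eq]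
  · have hxu : x ⬝ᵥ M.mulVec u1 = u1 ⬝ᵥ M.mulVec x :=
      dotProduct_mulVec_comm_of_isSymm hMs x u1
    have hform : star x ⬝ᵥ
        (K - lam1 • M + w • vecMulVec (M.mulVec u1) (M.mulVec u1)).mulVec x =
          x ⬝ᵥ (K - lam1 • M).mulVec x + w * (u1 ⬝ᵥ M.mulVec x) ^ 2 := by
      simp only [star_trivial, add_mulVec, smul_mulVec, vecMulVec_mulVec, dotProduct_add,
        dotProduct_smul, smul_eq_mul, op_smul_eq_smul, dotProduct_comm _ x, hxu]
      ring
    rw [hform]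
    have hpos : 0 < x ⬝ᵥ M.mulVec x := by simpa using hM.dotProduct_mulVec_pos hx
    exact (mul_pos (lt_min (sub_pos.mpr hlt) hw) hpos).trans_le (hbound x)
end
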